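/- Let 𝒯 be a Δ-tiling which satisfies the local isomorphism property. Then 𝒯 is locally isomorphic to a rigid Δ-tiling if and only if for every r ≥ 1 there exists T ∈ 𝒯 such that no σ ∈ G ∖ {Id} with 𝒯σ = 𝒯 satisfies Tσ ∈ B_r^𝒯(T). (Corollary 4.2) -/

import Mathlib

open Set Metric

namespace Paper

variable {E : Type*} [MetricSpace E]

/-- Image of a tile under an isometry (right action of `σ` on tiles). -/
def tmap (σ : E ≃ᵢ E) (T : Set E) : Set E := σ '' T

/-- Image of a set of tiles under an isometry. -/
def smap (σ : E ≃ᵢ E) (ℰ : Set (Set E)) : Set (Set E) := tmap σ '' ℰ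

/-- `bt ℰ T n` is the set `B_n^ℰ(T)` of tiles of `ℰ` at combinatorial distance at most `n`
from `T`. -/
def bt (ℰ : Set (Set E)) (T : Set E) : ℕ → Set (Set E)
  | 0 => {T}
  | n + 1 => {U | U ∈ ℰ ∧ ∃ V ∈ bt ℰ T n, (U ∩ V).Nonempty}

/-- A tile is a closed bounded subset of `E`. -/
def IsTile (T : Set E) : Prop := IsClosed T ∧ Bornology.IsBounded T

variable (G : Subgroup (E ≃ᵢ E))

/-- `(ℰ,T) ≅ (ℰ',T')` modulo `G`. -/
def PIso (ℰ : Set (Set E)) (T : Set E) (ℰ' : Set (Set E)) (T' : Set E) : Prop :=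
  ∃ σ ∈ G, smap σ ℰ = ℰ' ∧ tmap σ T = T'

/-- `(ℰ,T) ≤ (ℰ',T')` modulo `G`. -/
def PLe (ℰ : Set (Set E)) (T : Set E) (ℰ' : Set (Set E)) (T' : Set E) : Prop :=
  ∃ σ ∈ G, smap σ ℰ ⊆ ℰ' ∧ tmap σ T = T'

/-- A `p`-configuration. -/
def IsConfig (p : ℕ) (ℰ : Set (Set E)) (T : Set E) : Prop :=
  ℰ.Finite ∧ T ∈ ℰ ∧ (∀ S ∈ ℰ, IsTile S) ∧ bt ℰ T p = ℰ ∧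
    ∀ S ∈ bt ℰ T (p - 1), S ⊆ interior (⋃₀ (bt ℰ S 1))

/-- A `p`-local rule: a finite family of pairwise nonisomorphic `p`-configurations
satisfying the two compatibility conditions. -/
structure LocalRule (E : Type*) [MetricSpace E] (G : Subgroup (E ≃ᵢ E)) where
  p : ℕ
  hp : 1 ≤ p
  m : ℕ
  C : Fin m → Set (Set E)
  c : Fin m → Set E
  config : ∀ i, IsConfig p (C i) (c i)
  nonIso : ∀ i j, i ≠ j → ¬ PIso G (C i) (c i) (C j) (c j)
  cond1 : ∀ i j, PLe G (bt (C i) (c i) 1) (c i) (bt (C j) (c j) 1) (c j) →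
    PIso G (bt (C i) (c i) 1) (c i) (bt (C j) (c j) 1) (c j)
  cond2 : ∀ i, ∀ S ∈ bt (C i) (c i) 1, ∃ j,
    PIso G (bt (C i) S (p - 1)) S (bt (C j) (c j) (p - 1)) (c j)

/-- A set of tiles satisfies a local rule `Γ` if each `(B_p^ℰ(T),T)` is isomorphic
to one of the configurations of `Γ`. -/
def Satisfies (Γ : LocalRule E G) (ℰ : Set (Set E)) : Prop :=
  ∀ T ∈ ℰ, ∃ i, PIso G (bt ℰ T Γ.p) T (Γ.C i) (Γ.c i)

/-- The pairs `(B_r^ℰ(T),T)`, `T ∈ ℰ`, fall into finitely many isomorphism classes. -/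
def FinClasses (ℰ : Set (Set E)) (r : ℕ) : Prop :=
  ∃ 𝒜 : Set (Set E), 𝒜.Finite ∧ 𝒜 ⊆ ℰ ∧
    ∀ T ∈ ℰ, ∃ S ∈ 𝒜, PIso G (bt ℰ S r) S (bt ℰ T r) T

/-- A tiling of `E`. -/
def IsTiling (𝒯 : Set (Set E)) : Prop :=
  (∀ T ∈ 𝒯, IsTile T) ∧ ⋃₀ 𝒯 = univ ∧
    ∀ r : ℕ, 1 ≤ r →
      (∀ T ∈ 𝒯, (bt 𝒯 T r).Finite ∧ ⋃₀ (bt 𝒯 T (r - 1)) ⊆ interior (⋃₀ (bt 𝒯 T r))) ∧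
      (∀ S ∈ 𝒯, ∀ T ∈ 𝒯, PLe G (bt 𝒯 S r) S (bt 𝒯 T r) T →
        PIso G (bt 𝒯 S r) S (bt 𝒯 T r) T) ∧
      FinClasses G 𝒯 r

/-- Standing hypothesis on the `q`-local rule `Δ`: no nontrivial element of `G` fixes all
the tiles of some `B_{q-1}^{𝒟_i}(D_i)`. -/
def RigidRule (Δ : LocalRule E G) : Prop :=
  ∀ i, ∀ σ ∈ G, (∀ T ∈ bt (Δ.C i) (Δ.c i) (Δ.p - 1), tmap σ T = T) → σ = 1

/-- A patch. -/
def IsPatch (ℰ : Set (Set E)) : Prop :=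
  ∀ S ∈ ℰ, ∀ T ∈ ℰ, ∃ r : ℕ, T ∈ bt ℰ S r

/-- `I_Γ(ℰ)`. -/
def IRule (Γ : LocalRule E G) (ℰ : Set (Set E)) : Set (Set E) :=
  {T | T ∈ ℰ ∧ ∃ i, PIso G (bt ℰ T Γ.p) T (Γ.C i) (Γ.c i)}

/-- A `Γ`-patch. -/
def IsRulePatch (Γ : LocalRule E G) (ℰ : Set (Set E)) : Prop :=
  (∀ T ∈ ℰ, ∃ i, PLe G (bt ℰ T Γ.p) T (Γ.C i) (Γ.c i)) ∧
    ∃ 𝒜 ⊆ IRule G Γ ℰ, IsPatch 𝒜 ∧ ℰ = ⋃ T ∈ 𝒜, bt ℰ T Γ.p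

/-- The local isomorphism property for a tiling. -/
def TilingLIP (𝒯 : Set (Set E)) : Prop :=
  ∀ ℰ ⊆ 𝒯, IsPatch ℰ → ℰ.Finite →
    ∃ k : ℕ, 1 ≤ k ∧ ∀ T ∈ 𝒯, ∃ σ ∈ G, smap σ ℰ ⊆ bt 𝒯 T k

/-- `𝒮 ⋐ 𝒯` for tilings: each finite subpatch of `𝒮` is isomorphic to a subpatch of `𝒯`. -/
def TSub (𝒮 𝒯 : Set (Set E)) : Prop :=
  ∀ ℰ ⊆ 𝒮, IsPatch ℰ → ℰ.Finite →
    ∃ ℱ ⊆ 𝒯, IsPatch ℱ ∧ ∃ σ ∈ G, smap σ ℰ = ℱ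

/-- Locally isomorphic tilings. -/
def TLocIso (𝒮 𝒯 : Set (Set E)) : Prop := TSub G 𝒮 𝒯 ∧ TSub G 𝒯 𝒮

/-- A rigid tiling: no nontrivial element of `G` leaves it globally invariant. -/
def TRigid (𝒯 : Set (Set E)) : Prop := ∀ σ ∈ G, smap σ 𝒯 = 𝒯 → σ = 1

/-- Every tile of the set is nonempty. -/
def TilesNonempty (ℰ : Set (Set E)) : Prop := ∀ T ∈ ℰ, T.Nonempty

/-- No nontrivial `σ ∈ G` moves `T` within distance `r` and maps `B_j^ℰ(T)` into
`B_{j+r}^ℰ(T)`. -/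
def NoShortPartialSymmetry (ℰ : Set (Set E)) (T : Set E) (r j : ℕ) : Prop :=
  ∀ σ ∈ G, σ ≠ 1 → tmap σ T ∈ bt ℰ T r → ¬ smap σ (bt ℰ T j) ⊆ bt ℰ T (j + r)

section Action

variable {σ : E ≃ᵢ E} {T U : Set E} {ℰ ℱ : Set (Set E)}

theorem tmap_one (T : Set E) : tmap (1 : E ≃ᵢ E) T = T := by
  simp [tmap]

theorem tmap_mul (σ τ : E ≃ᵢ E) (T : Set E) : tmap (σ * τ) T = tmap σ (tmap τ T) := by
  simp [tmap, image_image]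

theorem tmap_inv_tmap (σ : E ≃ᵢ E) (T : Set E) : tmap σ⁻¹ (tmap σ T) = T := by
  rw [← tmap_mul, inv_mul_cancel, tmap_one]

theorem tmap_injective (σ : E ≃ᵢ E) : Function.Injective (tmap σ) :=
  Function.LeftInverse.injective (tmap_inv_tmap σ)

theorem smap_one (ℰ : Set (Set E)) : smap (1 : E ≃ᵢ E) ℰ = ℰ := by
  simp [smap, tmap_one]

theorem smap_mul (σ τ : E ≃ᵢ E) (ℰ : Set (Set E)) :
    smap (σ * τ) ℰ = smap σ (smap τ ℰ) := by
  simp [smap, image_image, tmap_mul]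

theorem smap_inv_smap (σ : E ≃ᵢ E) (ℰ : Set (Set E)) : smap σ⁻¹ (smap σ ℰ) = ℰ := by
  rw [← smap_mul, inv_mul_cancel, smap_one]

theorem smap_smap_inv (σ : E ≃ᵢ E) (ℰ : Set (Set E)) : smap σ (smap σ⁻¹ ℰ) = ℰ := by
  rw [← smap_mul, mul_inv_cancel, smap_one]

theorem smap_mono (h : ℰ ⊆ ℱ) : smap σ ℰ ⊆ smap σ ℱ := image_mono h

theorem smap_subset_smap_iff (σ : E ≃ᵢ E) : smap σ ℰ ⊆ smap σ ℱ ↔ ℰ ⊆ ℱ :=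
  image_subset_image_iff (tmap_injective σ)

theorem tmap_mem_smap (h : T ∈ ℰ) : tmap σ T ∈ smap σ ℰ := mem_image_of_mem _ h

theorem tmap_inv_mem (h : T ∈ smap σ ℰ) : tmap σ⁻¹ T ∈ ℰ := by
  obtain ⟨U, hU, rfl⟩ := h
  rwa [tmap_inv_tmap]

theorem sUnion_smap (σ : E ≃ᵢ E) (ℰ : Set (Set E)) : ⋃₀ smap σ ℰ = σ '' ⋃₀ ℰ := by
  rw [smap, sUnion_image, sUnion_eq_biUnion, image_iUnion₂]
  rfl

theorem interior_sUnion_smap (σ : E ≃ᵢ E) (ℰ : Set (Set E)) :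
    interior (⋃₀ smap σ ℰ) = σ '' interior (⋃₀ ℰ) := by
  rw [sUnion_smap]
  exact (σ.toHomeomorph.image_interior _).symm

theorem IsTile.tmap (h : IsTile T) (σ : E ≃ᵢ E) : IsTile (tmap σ T) :=
  ⟨σ.toHomeomorph.isClosedMap _ h.1, σ.isometry.lipschitz.isBounded_image h.2⟩

theorem tmap_inter_nonempty :
    (tmap σ T ∩ tmap σ U).Nonempty ↔ (T ∩ U).Nonempty := by
  rw [tmap, tmap, ← image_inter σ.injective, image_nonempty]

theorem TilesNonempty.smap (h : TilesNonempty ℰ) (σ : E ≃ᵢ E) :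
    TilesNonempty (smap σ ℰ) := by
  rintro _ ⟨T, hT, rfl⟩
  exact (h T hT).image _

theorem bt_smap (σ : E ≃ᵢ E) (ℰ : Set (Set E)) (T : Set E) (n : ℕ) :
    bt (smap σ ℰ) (tmap σ T) n = smap σ (bt ℰ T n) := by
  induction n with
  | zero => simp [bt, smap]
  | succ n ih =>
    ext U
    constructor
    · rintro ⟨⟨U, hU, rfl⟩, V, hV, hUV⟩
      rw [ih] at hV
      obtain ⟨V, hV, rfl⟩ := hV
      exact ⟨U, ⟨hU, V, hV, tmap_inter_nonempty.1 hUV⟩, rfl⟩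
    · rintro ⟨U, ⟨hU, V, hV, hUV⟩, rfl⟩
      refine ⟨tmap_mem_smap hU, tmap σ V, ?_, tmap_inter_nonempty.2 hUV⟩
      rw [ih]
      exact tmap_mem_smap hV

end Action

section Balls

set_option linter.unusedSectionVars false

variable {S T U V : Set E} {ℰ ℱ : Set (Set E)} {i j n : ℕ}

theorem bt_subset (hT : T ∈ ℰ) : bt ℰ T n ⊆ ℰ := by
  cases n with
  | zero => simpa [bt] using hT
  | succ n => exact fun U hU => hU.1

theorem bt_mono_set (h : ℰ ⊆ ℱ) : bt ℰ T n ⊆ bt ℱ T n := by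
  induction n with
  | zero => exact subset_rfl
  | succ n ih => exact fun U ⟨hU, V, hV, hUV⟩ => ⟨h hU, V, ih hV, hUV⟩

theorem bt_mono (hne : TilesNonempty ℰ) (hT : T ∈ ℰ) : Monotone (bt ℰ T) := by
  refine monotone_nat_of_le_succ fun n U hU => ?_
  have hU' := bt_subset hT hU
  exact ⟨hU', U, hU, by simpa using hne U hU'⟩

theorem mem_bt_self (hne : TilesNonempty ℰ) (hT : T ∈ ℰ) (n : ℕ) : T ∈ bt ℰ T n :=
  bt_mono hne hT (Nat.zero_le n) rfl

theorem bt_trans (hU : U ∈ bt ℰ T i) (hV : V ∈ bt ℰ U j) : V ∈ bt ℰ T (i + j) := by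
  induction j generalizing V with
  | zero => obtain rfl : V = U := hV; exact hU
  | succ j ih =>
    obtain ⟨hV, W, hW, hVW⟩ := hV
    exact ⟨hV, W, ih hW, hVW⟩

theorem bt_symm (hT : T ∈ ℰ) (hU : U ∈ bt ℰ T n) : T ∈ bt ℰ U n := by
  induction n generalizing U with
  | zero => exact Eq.symm hU
  | succ n ih =>
    obtain ⟨hU, V, hV, hUV⟩ := hU
    rw [add_comm]
    have hVU : V ∈ bt ℰ U 1 := ⟨bt_subset hT hV, U, rfl, by rwa [inter_comm]⟩
    exact bt_trans hVU (ih hV)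

theorem bt_subset_bt_of_subset (hne : TilesNonempty ℰ) (hT : T ∈ ℰ)
    (h : bt ℰ T n ⊆ ℱ) (hS : S ∈ bt ℰ T i) (hij : i + j ≤ n) : bt ℰ S j ⊆ bt ℱ S j := by
  induction j with
  | zero => exact subset_rfl
  | succ j ih =>
    intro U hU
    refine ⟨h (bt_mono hne hT hij (bt_trans hS hU)), ?_⟩
    obtain ⟨-, V, hV, hUV⟩ := hU
    exact ⟨V, ih (by omega) hV, hUV⟩

theorem bt_congr (hne : TilesNonempty ℰ) (hne' : TilesNonempty ℱ) (hT : T ∈ ℰ) (hT' : T ∈ ℱ)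
    (h : bt ℰ T n = bt ℱ T n) (hS : S ∈ bt ℰ T i) (hij : i + j ≤ n) :
    bt ℰ S j = bt ℱ S j := by
  have h₁ : bt ℰ T n ⊆ ℱ := h ▸ bt_subset hT'
  have h₂ : bt ℱ T n ⊆ ℰ := h ▸ bt_subset hT
  have hS' : S ∈ bt ℱ T i :=
    bt_subset_bt_of_subset hne hT h₁ (i := 0) rfl (by omega) hS
  exact (bt_subset_bt_of_subset hne hT h₁ hS hij).antisymm
    (bt_subset_bt_of_subset hne' hT' h₂ hS' hij)

theorem bt_bt (hne : TilesNonempty ℰ) (hT : T ∈ ℰ) (hij : j ≤ n) :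
    bt (bt ℰ T n) T j = bt ℰ T j :=
  (bt_mono_set (bt_subset hT)).antisymm
    (bt_subset_bt_of_subset hne hT subset_rfl (i := 0) rfl (by omega))

theorem isPatch_bt (hne : TilesNonempty ℰ) (hT : T ∈ ℰ) : IsPatch (bt ℰ T n) := by
  intro S hS U hU
  rw [← bt_bt hne hT le_rfl] at hS hU
  exact ⟨n + n, bt_trans (bt_symm (mem_bt_self hne hT n) hS) hU⟩

theorem smap_bt_subset {σ : E ≃ᵢ E} (hne : TilesNonempty ℰ) (hT : T ∈ ℰ)
    (h : smap σ (bt ℰ T n) ⊆ ℱ) : smap σ (bt ℰ T n) ⊆ bt ℱ (tmap σ T) n := by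
  conv_lhs => rw [← bt_bt hne hT le_rfl, ← bt_smap]
  exact bt_mono_set h

theorem IsPatch.smap (h : IsPatch ℰ) (σ : E ≃ᵢ E) : IsPatch (smap σ ℰ) := by
  rintro _ ⟨S, hS, rfl⟩ _ ⟨T, hT, rfl⟩
  obtain ⟨r, hr⟩ := h S hS T hT
  refine ⟨r, ?_⟩
  rw [bt_smap]
  exact tmap_mem_smap hr

theorem IsPatch.exists_subset_bt (hne : TilesNonempty ℱ) (hℰ : ℰ ⊆ ℱ) (hp : IsPatch ℰ)
    (hfin : ℰ.Finite) (hT : T ∈ ℰ) : ∃ r, ℰ ⊆ bt ℱ T r := by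
  choose! f hf using hp T hT
  obtain ⟨r, hr⟩ := (hfin.image f).bddAbove
  exact ⟨r, fun U hU => bt_mono hne (hℰ hT) (hr (mem_image_of_mem f hU))
    (bt_mono_set hℰ (hf U hU))⟩

/-- The balls of the limit of a sequence of sets of tiles which stabilizes around `T`. -/
theorem bt_iUnion_bt {A : ℕ → Set (Set E)} {k : ℕ → ℕ} (hne : ∀ n, TilesNonempty (A n))
    (hT : ∀ n, T ∈ A n) (hk : StrictMono k)
    (hA : ∀ n, bt (A (n + 1)) T (k n) = bt (A n) T (k n)) (n : ℕ) :
    bt (⋃ m, bt (A m) T (k m)) T (k n) = bt (A n) T (k n) := by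
  have agree : ∀ m, n ≤ m → ∀ j ≤ k n, bt (A m) T j = bt (A n) T j := by
    intro m hm
    induction m, hm using Nat.le_induction with
    | base => exact fun _ _ => rfl
    | succ m hm ih =>
      intro j hj
      rw [← ih j hj]
      exact bt_congr (hne _) (hne _) (hT _) (hT _) (hA m) (i := 0) rfl
        (by have := hk.monotone hm; omega)
  have mono : Monotone fun m => bt (A m) T (k m) := by
    refine monotone_nat_of_le_succ fun m => ?_
    rw [← hA m]
    exact bt_mono (hne _) (hT _) (hk.monotone m.le_succ)
  suffices h : ∀ j ≤ k n, bt (⋃ m, bt (A m) T (k m)) T j = bt (A n) T j from h _ le_rfl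
  intro j
  induction j with
  | zero => exact fun _ => rfl
  | succ j ih =>
    intro hj
    ext U
    constructor
    · rintro ⟨hU, V, hV, hUV⟩
      obtain ⟨m, hm⟩ := mem_iUnion.1 hU
      rw [ih (by omega), ← agree (max m n) (le_max_right _ _) j (by omega)] at hV
      rw [← agree (max m n) (le_max_right _ _) _ hj]
      exact ⟨bt_subset (hT _) (mono (le_max_left m n) hm), V, hV, hUV⟩
    · intro hU
      refine ⟨mem_iUnion.2 ⟨n, bt_mono (hne _) (hT _) hj hU⟩, ?_⟩
      obtain ⟨-, V, hV, hUV⟩ := hU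
      exact ⟨V, by rwa [ih (by omega)], hUV⟩

/-- A symmetry of `ℰ` moving `T` within distance `r` is seen as a partial symmetry in every
set of tiles which coincides with a copy of `ℰ` around `T`. -/
theorem not_noShortPartialSymmetry {ρ τ : E ≃ᵢ E} {G : Subgroup (E ≃ᵢ E)} {r j : ℕ}
    (hne : TilesNonempty ℰ) (hne' : TilesNonempty ℱ) (hT : T ∈ ℰ) (hρT : tmap ρ T ∈ ℱ)
    (hρ : ρ ∈ G) (h : smap ρ (bt ℰ T (j + r)) = bt ℱ (tmap ρ T) (j + r))
    (hτ : τ ∈ G) (hτ1 : τ ≠ 1) (hτℰ : smap τ ℰ = ℰ) (hτT : tmap τ T ∈ bt ℰ T r) :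
    ¬ NoShortPartialSymmetry G ℱ (tmap ρ T) r j := by
  have key : ∀ i ≤ j + r, bt ℱ (tmap ρ T) i = smap ρ (bt ℰ T i) := by
    intro i hi
    rw [← bt_smap] at h ⊢
    exact (bt_congr (hne.smap ρ) hne' (tmap_mem_smap hT) hρT h (i := 0) rfl (by omega)).symm
  have hconj : ∀ V, tmap (ρ * τ * ρ⁻¹) (tmap ρ V) = tmap ρ (tmap τ V) := by
    intro V
    rw [tmap_mul, tmap_inv_tmap, tmap_mul]
  intro hno
  refine hno (ρ * τ * ρ⁻¹) (mul_mem (mul_mem hρ hτ) (inv_mem hρ)) ?_ ?_ ?_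
  · intro h1
    apply hτ1
    rwa [mul_inv_eq_one, mul_eq_left] at h1
  · rw [hconj, key r (by omega)]
    exact tmap_mem_smap hτT
  · rw [key j (by omega), key _ le_rfl]
    rintro _ ⟨_, ⟨V, hV, rfl⟩, rfl⟩
    rw [hconj]
    refine tmap_mem_smap ?_
    rw [add_comm]
    refine bt_trans hτT ?_
    rw [← hτℰ, bt_smap]
    exact tmap_mem_smap hV

end Balls

section Isomorphism

variable {G} {S T T' T'' : Set E} {ℰ ℰ' ℰ'' 𝒯 : Set (Set E)}

theorem PIso.symm (h : PIso G ℰ T ℰ' T') : PIso G ℰ' T' ℰ T := by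
  obtain ⟨σ, hσ, rfl, rfl⟩ := h
  exact ⟨σ⁻¹, inv_mem hσ, smap_inv_smap _ _, tmap_inv_tmap _ _⟩

theorem PIso.trans (h : PIso G ℰ T ℰ' T') (h' : PIso G ℰ' T' ℰ'' T'') :
    PIso G ℰ T ℰ'' T'' := by
  obtain ⟨σ, hσ, rfl, rfl⟩ := h
  obtain ⟨τ, hτ, rfl, rfl⟩ := h'
  exact ⟨τ * σ, mul_mem hτ hσ, smap_mul _ _ _, tmap_mul _ _ _⟩

theorem PIso.ple (h : PIso G ℰ T ℰ' T') : PLe G ℰ T ℰ' T' := by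
  obtain ⟨σ, hσ, hs, ht⟩ := h
  exact ⟨σ, hσ, hs.subset, ht⟩

theorem PLe.trans (h : PLe G ℰ T ℰ' T') (h' : PLe G ℰ' T' ℰ'' T'') :
    PLe G ℰ T ℰ'' T'' := by
  obtain ⟨σ, hσ, hs, rfl⟩ := h
  obtain ⟨τ, hτ, hs', rfl⟩ := h'
  refine ⟨τ * σ, mul_mem hτ hσ, ?_, tmap_mul _ _ _⟩
  rw [smap_mul]
  exact (smap_mono hs).trans hs'

theorem Satisfies.tilesNonempty {Δ : LocalRule E G} (h : Satisfies G Δ 𝒯) :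
    TilesNonempty 𝒯 := by
  intro T hT
  obtain ⟨i, σ, hσ, hs, ht⟩ := h T hT
  have hc := (Δ.config i).2.1
  rw [← hs, ← ht] at hc
  have hT' := tmap_inv_mem hc
  rw [tmap_inv_tmap] at hT'
  obtain ⟨p, hp⟩ := Nat.exists_eq_add_of_le' Δ.hp
  rw [hp] at hT'
  obtain ⟨-, V, -, hV⟩ := hT'
  exact hV.left

theorem IsTiling.finite_bt (h : IsTiling G 𝒯) (hT : T ∈ 𝒯) (n : ℕ) : (bt 𝒯 T n).Finite := by
  cases n with
  | zero => exact finite_singleton T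
  | succ n => exact ((h.2.2 (n + 1) (by omega)).1 T hT).1

theorem IsTiling.nonempty [Nonempty E] (h : IsTiling G 𝒯) : 𝒯.Nonempty := by
  have : (⋃₀ 𝒯).Nonempty := h.2.1 ▸ univ_nonempty
  obtain ⟨_, T, hT, -⟩ := this
  exact ⟨T, hT⟩

theorem IsTiling.smap_bt_eq (h : IsTiling G 𝒯) (hne : TilesNonempty 𝒯) {σ : E ≃ᵢ E}
    (hσ : σ ∈ G) (hT : T ∈ 𝒯) (n : ℕ) (hs : smap σ (bt 𝒯 T n) ⊆ 𝒯) :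
    smap σ (bt 𝒯 T n) = bt 𝒯 (tmap σ T) n := by
  have hσT : tmap σ T ∈ 𝒯 := hs (tmap_mem_smap (mem_bt_self hne hT n))
  cases n with
  | zero => simp [bt, smap]
  | succ n =>
    have hsub := smap_bt_subset hne hT hs
    obtain ⟨τ, hτ, hτs, -⟩ := (h.2.2 (n + 1) (by omega)).2.1 T hT _ hσT ⟨σ, hσ, hsub, rfl⟩
    refine eq_of_subset_of_ncard_le hsub ?_ (h.finite_bt hσT _)
    rw [← hτs, smap, smap, ncard_image_of_injective _ (tmap_injective _),
      ncard_image_of_injective _ (tmap_injective _)]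

theorem IsTiling.isPatch [ConnectedSpace E] (h : IsTiling G 𝒯) (hne : TilesNonempty 𝒯) :
    IsPatch 𝒯 := by
  intro T hT
  have nhds : ∀ S ∈ 𝒯, ∀ y ∈ S, ⋃₀ bt 𝒯 S 1 ∈ nhds y := fun S hS y hy =>
    mem_interior_iff_mem_nhds.1 (((h.2.2 1 le_rfl).1 S hS).2 ⟨S, rfl, hy⟩)
  have hclopen : IsClopen {x | ∃ n, ∃ U ∈ bt 𝒯 T n, x ∈ U} := by
    constructor
    · rw [← isOpen_compl_iff, isOpen_iff_mem_nhds]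
      intro y hy
      obtain ⟨S, hS, hyS⟩ : y ∈ ⋃₀ 𝒯 := h.2.1 ▸ mem_univ y
      filter_upwards [nhds S hS y hyS]
      rintro z ⟨V, hV, hzV⟩ ⟨n, W, hW, hzW⟩
      have hVT : V ∈ bt 𝒯 T (n + 1) := ⟨bt_subset hS hV, W, hW, z, hzV, hzW⟩
      exact hy ⟨n + 1 + 1, S, bt_trans hVT (bt_symm hS hV), hyS⟩
    · rw [isOpen_iff_mem_nhds]
      rintro y ⟨n, U, hU, hyU⟩
      filter_upwards [nhds U (bt_subset hT hU) y hyU]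
      rintro z ⟨V, hV, hzV⟩
      exact ⟨n + 1, V, bt_trans hU hV, hzV⟩
  have huniv := hclopen.eq_univ
    (let ⟨x, hx⟩ := hne T hT; ⟨x, 0, T, rfl, hx⟩)
  intro S hS
  obtain ⟨x, hx⟩ := hne S hS
  obtain ⟨n, U, hU, hxU⟩ : x ∈ {x | ∃ n, ∃ U ∈ bt 𝒯 T n, x ∈ U} := huniv ▸ mem_univ x
  exact ⟨n + 1, hS, U, hU, x, hx, hxU⟩

/-- Some neighbourhood of fixed radius of each tile `T` is covered by `B_1^𝒯(T)`. -/
theorem IsTiling.exists_ball_subset (hcomp : ∀ (x : E) (η : ℝ), IsCompact (closedBall x η))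
    (h : IsTiling G 𝒯) :
    ∃ ε > 0, ∀ T ∈ 𝒯, ∀ x ∈ T, ball x ε ⊆ ⋃₀ bt 𝒯 T 1 := by
  obtain ⟨hint, -, 𝒜, hfin, h𝒜, hcls⟩ := h.2.2 1 le_rfl
  have hev : ∀ᶠ ε in nhdsWithin (0 : ℝ) (Ioi 0), ∀ S ∈ 𝒜,
      thickening ε S ⊆ ⋃₀ bt 𝒯 S 1 := by
    rw [Filter.eventually_all_finite hfin]
    intro S hS
    have hS' := h𝒜 hS
    have hSc : IsCompact S := by
      rcases S.eq_empty_or_nonempty with rfl | ⟨x, -⟩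
      · exact isCompact_empty
      · obtain ⟨η, hη⟩ := (h.1 S hS').2.subset_closedBall x
        exact (hcomp x η).of_isClosed_subset (h.1 S hS').1 hη
    have hSi : S ⊆ interior (⋃₀ bt 𝒯 S 1) := fun x hx => (hint S hS').2 ⟨S, rfl, hx⟩
    obtain ⟨δ, hδ, hsub⟩ := hSc.exists_thickening_subset_open isOpen_interior hSi
    filter_upwards [Ioo_mem_nhdsGT hδ] with ε hε
    exact (thickening_mono hε.2.le S).trans (hsub.trans interior_subset)
  obtain ⟨ε, hε, hε0⟩ := (hev.and self_mem_nhdsWithin).exists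
  refine ⟨ε, hε0, fun T hT x hx y hy => ?_⟩
  obtain ⟨S, hS, σ, -, hs, rfl⟩ := hcls T hT
  rw [← hs, sUnion_smap]
  obtain ⟨x, hx, rfl⟩ := hx
  refine ⟨σ.symm y, hε S hS (mem_thickening_iff.2 ⟨x, hx, ?_⟩), σ.apply_symm_apply y⟩
  rw [← σ.dist_eq, σ.apply_symm_apply]
  exact hy

theorem RigidRule.eq_one {Δ : LocalRule E G} (hΔ : RigidRule G Δ) (h : Satisfies G Δ 𝒯)
    (hT : T ∈ 𝒯) {σ : E ≃ᵢ E} (hσ : σ ∈ G)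
    (hfix : ∀ U ∈ bt 𝒯 T (Δ.p - 1), tmap σ U = U) : σ = 1 := by
  obtain ⟨i, ρ, hρ, hs, ht⟩ := h T hT
  have hball : bt (Δ.C i) (Δ.c i) (Δ.p - 1) = smap ρ (bt 𝒯 T (Δ.p - 1)) := by
    rw [← hs, ← ht, bt_smap, bt_bt h.tilesNonempty hT (by omega)]
  have h1 := hΔ i (ρ * σ * ρ⁻¹) (mul_mem (mul_mem hρ hσ) (inv_mem hρ)) (by
    rw [hball]
    rintro _ ⟨U, hU, rfl⟩
    rw [tmap_mul, tmap_inv_tmap, tmap_mul, hfix U hU])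
  rwa [mul_inv_eq_one, mul_eq_left] at h1

/-- Partial symmetries defined on arbitrarily large balls, moving a tile within a fixed
distance, yield a symmetry of the whole tiling. -/
theorem exists_symmetry_of_partial [ConnectedSpace E] {Δ : LocalRule E G}
    (hΔ : RigidRule G Δ) (h : IsTiling G 𝒯) (hsat : Satisfies G Δ 𝒯) (hT : T ∈ 𝒯) {r : ℕ}
    (hno : ∀ j, ¬ NoShortPartialSymmetry G 𝒯 T r j) :
    ∃ σ ∈ G, σ ≠ 1 ∧ smap σ 𝒯 = 𝒯 ∧ tmap σ T ∈ bt 𝒯 T r := by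
  have hne := hsat.tilesNonempty
  set d := Δ.p - 1
  set F : Set (E ≃ᵢ E) := {σ | σ ∈ G ∧ smap σ (bt 𝒯 T d) ⊆ bt 𝒯 T (d + r)}
  have hfin : F.Finite := by
    have := (h.finite_bt hT d).to_subtype
    have := (h.finite_bt hT (d + r)).to_subtype
    let g : F → bt 𝒯 T d → bt 𝒯 T (d + r) :=
      fun σ U => ⟨tmap σ U, σ.2.2 (tmap_mem_smap U.2)⟩
    refine @Finite.of_injective _ _ inferInstance g fun σ τ hστ => Subtype.ext ?_
    have h1 := hΔ.eq_one hsat hT (mul_mem (inv_mem τ.2.1) σ.2.1) (fun U hU => by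
      have hU' : tmap (σ : E ≃ᵢ E) U = tmap (τ : E ≃ᵢ E) U :=
        congrArg Subtype.val (congrFun hστ ⟨U, hU⟩)
      rw [tmap_mul, hU', tmap_inv_tmap])
    exact (inv_mul_eq_one.1 h1).symm
  obtain ⟨σ, hσ, hσ1, hσT, hσs⟩ : ∃ σ ∈ G, σ ≠ 1 ∧ tmap σ T ∈ bt 𝒯 T r ∧
      ∀ j, smap σ (bt 𝒯 T j) ⊆ 𝒯 := by
    by_contra! hcon
    have hcon' : ∀ σ, ∃ j, σ ∈ G → σ ≠ 1 → tmap σ T ∈ bt 𝒯 T r →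
        ¬ smap σ (bt 𝒯 T j) ⊆ 𝒯 := by
      intro σ
      by_cases hσ : σ ∈ G ∧ σ ≠ 1 ∧ tmap σ T ∈ bt 𝒯 T r
      · obtain ⟨j, hj⟩ := hcon σ hσ.1 hσ.2.1 hσ.2.2
        exact ⟨j, fun _ _ _ => hj⟩
      · exact ⟨0, fun h1 h2 h3 => absurd ⟨h1, h2, h3⟩ hσ⟩
    choose f hf using hcon'
    obtain ⟨b, hb⟩ := (hfin.image f).bddAbove
    have hcert := hno (max b d)
    simp only [NoShortPartialSymmetry] at hcert
    push Not at hcert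
    obtain ⟨σ, hσ, hσ1, hσT, hσs⟩ := hcert
    have hs : smap σ (bt 𝒯 T (max b d)) ⊆ 𝒯 := hσs.trans (bt_subset hT)
    have hσF : σ ∈ F := by
      refine ⟨hσ, fun U hU => ?_⟩
      have hU' := smap_bt_subset hne hT
        ((smap_mono (bt_mono hne hT (le_max_right b d))).trans hs) hU
      rw [add_comm]
      exact bt_trans hσT hU'
    exact hf σ hσ hσ1 hσT ((smap_mono (bt_mono hne hT
      ((hb (mem_image_of_mem f hσF)).trans (le_max_left b d)))).trans hs)
  refine ⟨σ, hσ, hσ1, ?_, hσT⟩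
  have hpatch := h.isPatch hne
  apply Subset.antisymm
  · rintro _ ⟨U, hU, rfl⟩
    obtain ⟨n, hn⟩ := hpatch T hT U hU
    exact hσs n (tmap_mem_smap hn)
  · intro U hU
    obtain ⟨n, hn⟩ := hpatch (tmap σ T) (bt_subset hT hσT) U hU
    rw [← h.smap_bt_eq hne hσ hT n (hσs n)] at hn
    obtain ⟨V, hV, rfl⟩ := hn
    exact tmap_mem_smap (bt_subset hT hV)

/-- Every ball of a tiling is a copy of a full ball of any locally isomorphic tiling. -/
theorem TLocIso.exists_smap_bt_eq {𝒯' : Set (Set E)} (hloc : TLocIso G 𝒯 𝒯')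
    (h : IsTiling G 𝒯) (h' : IsTiling G 𝒯') (hne : TilesNonempty 𝒯)
    (hne' : TilesNonempty 𝒯') (hT : T ∈ 𝒯') (n : ℕ) :
    ∃ ρ ∈ G, tmap ρ T ∈ 𝒯 ∧ smap ρ (bt 𝒯' T n) = bt 𝒯 (tmap ρ T) n := by
  obtain ⟨_, hℱ, -, ρ, hρ, rfl⟩ :=
    hloc.2 _ (bt_subset hT) (isPatch_bt hne' hT) (h'.finite_bt hT n)
  have hρT : tmap ρ T ∈ 𝒯 := hℱ (tmap_mem_smap (mem_bt_self hne' hT n))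
  obtain ⟨_, hℱ', -, π, hπ, rfl⟩ :=
    hloc.1 _ (bt_subset hρT) (isPatch_bt hne hρT) (h.finite_bt hρT n)
  have hsub := smap_bt_subset hne' hT hℱ
  refine ⟨ρ, hρ, hρT, hsub.antisymm ((smap_subset_smap_iff π).1 ?_)⟩
  rw [← smap_mul, h'.smap_bt_eq hne' (mul_mem hπ hρ) hT n, tmap_mul]
  · exact smap_bt_subset hne hρT hℱ'
  · rw [smap_mul]
    exact (smap_mono hsub).trans hℱ'

/-- A connected set of tiles all of whose balls are copies of balls of `𝒯` is a tiling. -/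
theorem IsTiling.of_locally_copied [ConnectedSpace E]
    (hcomp : ∀ (x : E) (η : ℝ), IsCompact (closedBall x η)) {𝒯' : Set (Set E)}
    (h : IsTiling G 𝒯) (hne : TilesNonempty 𝒯) (hnon : 𝒯'.Nonempty)
    (hloc : ∀ T ∈ 𝒯', ∀ r, ∃ ρ ∈ G, tmap ρ T ∈ 𝒯 ∧
      smap ρ (bt 𝒯' T r) = bt 𝒯 (tmap ρ T) r) : IsTiling G 𝒯' := by
  have hne' : TilesNonempty 𝒯' := by
    intro T hT
    obtain ⟨ρ, -, hρT, -⟩ := hloc T hT 0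
    exact image_nonempty.1 (hne _ hρT)
  refine ⟨fun T hT => ?_, ?_, fun r hr => ⟨fun T hT => ?_, fun S hS T hT hle => ?_, ?_⟩⟩
  · obtain ⟨ρ, -, hρT, -⟩ := hloc T hT 0
    have := (h.1 _ hρT).tmap ρ⁻¹
    rwa [tmap_inv_tmap] at this
  · obtain ⟨ε, hε, hball⟩ := h.exists_ball_subset hcomp
    have hball' : ∀ x ∈ ⋃₀ 𝒯', ball x ε ⊆ ⋃₀ 𝒯' := by
      rintro x ⟨T, hT, hx⟩ y hy
      obtain ⟨ρ, -, hρT, hρ⟩ := hloc T hT 1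
      have hy' : ρ y ∈ ball (ρ x) ε := by rwa [mem_ball, ρ.dist_eq]
      have := hball _ hρT _ (mem_image_of_mem ρ hx) hy'
      rw [← hρ, sUnion_smap, ρ.injective.mem_set_image] at this
      exact sUnion_mono (bt_subset hT) this
    refine IsClopen.eq_univ ⟨?_, ?_⟩ ?_
    · refine isClosed_of_closure_subset fun y hy => ?_
      obtain ⟨x, hx, hxy⟩ := Metric.mem_closure_iff.1 hy ε hε
      exact hball' x hx hxy
    · exact Metric.isOpen_iff.2 fun x hx => ⟨ε, hε, hball' x hx⟩
    · obtain ⟨T, hT⟩ := hnon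
      obtain ⟨x, hx⟩ := hne' T hT
      exact ⟨x, T, hT, hx⟩
  · obtain ⟨ρ, -, hρT, hρ⟩ := hloc T hT r
    obtain ⟨hfin, hint⟩ := (h.2.2 r hr).1 _ hρT
    rw [← hρ] at hfin hint
    refine ⟨hfin.of_finite_image (tmap_injective ρ).injOn, ?_⟩
    have hpred : bt 𝒯 (tmap ρ T) (r - 1) = smap ρ (bt 𝒯' T (r - 1)) := by
      rw [← bt_smap] at hρ ⊢
      exact (bt_congr (hne'.smap ρ) hne (tmap_mem_smap hT) hρT hρ (i := 0) rfl
        (by omega)).symm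
    rw [hpred, interior_sUnion_smap, sUnion_smap] at hint
    exact (image_subset_image_iff ρ.injective).1 hint
  · obtain ⟨ρ, hρG, hρS, hρ⟩ := hloc S hS r
    obtain ⟨π, hπG, hπT, hπ⟩ := hloc T hT r
    have isoS : PIso G (bt 𝒯' S r) S (bt 𝒯 (tmap ρ S) r) (tmap ρ S) := ⟨ρ, hρG, hρ, rfl⟩
    have isoT : PIso G (bt 𝒯' T r) T (bt 𝒯 (tmap π T) r) (tmap π T) := ⟨π, hπG, hπ, rfl⟩
    exact (isoS.trans ((h.2.2 r hr).2.1 _ hρS _ hπT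
      (isoS.symm.ple.trans (hle.trans isoT.ple)))).trans isoT.symm
  · obtain ⟨𝒜, hfin, -, hcls⟩ := (h.2.2 r hr).2.2
    have hcls' : ∀ T ∈ 𝒯', ∃ S ∈ 𝒜, PIso G (bt 𝒯 S r) S (bt 𝒯' T r) T := by
      intro T hT
      obtain ⟨ρ, hρG, hρT, hρ⟩ := hloc T hT r
      obtain ⟨S, hS, hST⟩ := hcls _ hρT
      exact ⟨S, hS, hST.trans (PIso.symm ⟨ρ, hρG, hρ, rfl⟩)⟩
    choose! f hf𝒜 hf using hcls'
    obtain ⟨ℬ, hℬ, hbij⟩ := exists_subset_bijOn 𝒯' f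
    refine ⟨ℬ, ?_, hℬ, fun T hT => ?_⟩
    · refine Set.Finite.of_finite_image (hfin.subset ?_) hbij.injOn
      rw [hbij.image_eq]
      exact image_subset_iff.2 hf𝒜
    · obtain ⟨S, hS, hST⟩ : f T ∈ f '' ℬ := hbij.image_eq ▸ mem_image_of_mem f hT
      exact ⟨S, hS, (hf S (hℬ hS)).symm.trans (hST ▸ hf T hT)⟩

end Isomorphism

section Construction

variable {G} {S T : Set E} {𝒯 : Set (Set E)}

/-- Given a ball of `𝒯`, some copy of it in `𝒯` is centered at a tile which no nontrivial
symmetry of `𝒯` moves within distance `r`. -/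
theorem exists_copy_no_short_symmetry (h : IsTiling G 𝒯) (hne : TilesNonempty 𝒯)
    (hlip : TilingLIP G 𝒯)
    (hsym : ∀ r : ℕ, 1 ≤ r → ∃ T ∈ 𝒯,
      ∀ σ ∈ G, σ ≠ 1 → smap σ 𝒯 = 𝒯 → tmap σ T ∉ bt 𝒯 T r)
    (hS : S ∈ 𝒯) (k r : ℕ) :
    ∃ τ ∈ G, tmap τ S ∈ 𝒯 ∧ smap τ (bt 𝒯 S k) = bt 𝒯 (tmap τ S) k ∧
      ∀ σ ∈ G, σ ≠ 1 → smap σ 𝒯 = 𝒯 → tmap σ (tmap τ S) ∉ bt 𝒯 (tmap τ S) r := by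
  obtain ⟨m, hm, hcopy⟩ := hlip _ (bt_subset hS) (isPatch_bt hne hS) (h.finite_bt hS k)
  obtain ⟨T, hT, hTsym⟩ := hsym (m + r + m) (by omega)
  obtain ⟨τ, hτ, hτs⟩ := hcopy T hT
  have hτST : tmap τ S ∈ bt 𝒯 T m := hτs (tmap_mem_smap (mem_bt_self hne hS k))
  refine ⟨τ, hτ, bt_subset hT hτST,
    h.smap_bt_eq hne hτ hS k (hτs.trans (bt_subset hT)), fun σ hσ hσ1 hσ𝒯 hmem => ?_⟩
  refine hTsym σ hσ hσ1 hσ𝒯 (bt_trans (bt_trans hτST hmem) ?_)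
  rw [← hσ𝒯, bt_smap]
  exact tmap_mem_smap (bt_symm hT hτST)

/-- A sequence of copies of `𝒯` which stabilizes on larger and larger balls around `T`, and
whose `n`-th term has no nontrivial partial symmetry moving `T` within distance `n - 1`. -/
theorem exists_stabilizing_sequence [ConnectedSpace E] {Δ : LocalRule E G}
    (hΔ : RigidRule G Δ) (h : IsTiling G 𝒯) (hsat : Satisfies G Δ 𝒯) (hlip : TilingLIP G 𝒯)
    (hsym : ∀ r : ℕ, 1 ≤ r → ∃ T ∈ 𝒯,
      ∀ σ ∈ G, σ ≠ 1 → smap σ 𝒯 = 𝒯 → tmap σ T ∉ bt 𝒯 T r)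
    (hT : T ∈ 𝒯) :
    ∃ (ρ : ℕ → E ≃ᵢ E) (k : ℕ → ℕ), StrictMono k ∧
      ∀ n, ρ n ∈ G ∧ T ∈ smap (ρ n) 𝒯 ∧
        bt (smap (ρ (n + 1)) 𝒯) T (k n) = bt (smap (ρ n) 𝒯) T (k n) ∧
        ∃ j, j + n ≤ k (n + 1) ∧
          NoShortPartialSymmetry G 𝒯 (tmap (ρ (n + 1))⁻¹ T) n j := by
  have hne := hsat.tilesNonempty
  let X := {x : (E ≃ᵢ E) × ℕ // x.1 ∈ G ∧ T ∈ smap x.1 𝒯}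
  have step : ∀ (n : ℕ) (x : X), ∃ y : X, x.1.2 < y.1.2 ∧
      bt (smap y.1.1 𝒯) T x.1.2 = bt (smap x.1.1 𝒯) T x.1.2 ∧
      ∃ j, j + n ≤ y.1.2 ∧ NoShortPartialSymmetry G 𝒯 (tmap y.1.1⁻¹ T) n j := by
    rintro n ⟨⟨σ, k⟩, hσ, S, hS, rfl⟩
    obtain ⟨τ, hτ, hτS, hτk, hτsym⟩ :=
      exists_copy_no_short_symmetry h hne hlip hsym hS k n
    obtain ⟨j, hj⟩ : ∃ j, NoShortPartialSymmetry G 𝒯 (tmap τ S) n j := by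
      by_contra! hcon
      obtain ⟨π, hπ, hπ1, hπ𝒯, hπS⟩ := exists_symmetry_of_partial hΔ h hsat hτS hcon
      exact hτsym π hπ hπ1 hπ𝒯 hπS
    have hcenter : tmap (σ * τ⁻¹) (tmap τ S) = tmap σ S := by
      rw [tmap_mul, tmap_inv_tmap]
    refine ⟨⟨(σ * τ⁻¹, max (k + 1) (j + n)), mul_mem hσ (inv_mem hτ), tmap τ S, hτS, hcenter⟩,
      Nat.lt_of_succ_le (le_max_left _ _), ?_, j, le_max_right _ _, ?_⟩
    · change bt (smap (σ * τ⁻¹) 𝒯) (tmap σ S) k = bt (smap σ 𝒯) (tmap σ S) k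
      rw [bt_smap, ← hcenter, bt_smap, ← hτk, smap_mul, smap_inv_smap]
    · change NoShortPartialSymmetry G 𝒯 (tmap (σ * τ⁻¹)⁻¹ (tmap σ S)) n j
      rwa [← hcenter, tmap_inv_tmap]
  choose next hlt hball hcert using step
  let x : ℕ → X := fun n =>
    Nat.rec ⟨(1, 0), one_mem G, by rwa [smap_one]⟩ (fun n y => next n y) n
  exact ⟨fun n => (x n).1.1, fun n => (x n).1.2, strictMono_nat_of_lt_succ fun n => hlt n (x n),
    fun n => ⟨(x n).2.1, (x n).2.2, hball n (x n), hcert n (x n)⟩⟩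

theorem exists_rigid_locIso [ConnectedSpace E]
    (hcomp : ∀ (x : E) (η : ℝ), IsCompact (closedBall x η)) {Δ : LocalRule E G}
    (hΔ : RigidRule G Δ) (h : IsTiling G 𝒯) (hsat : Satisfies G Δ 𝒯) (hlip : TilingLIP G 𝒯)
    (hsym : ∀ r : ℕ, 1 ≤ r → ∃ T ∈ 𝒯,
      ∀ σ ∈ G, σ ≠ 1 → smap σ 𝒯 = 𝒯 → tmap σ T ∉ bt 𝒯 T r) :
    ∃ 𝒯' : Set (Set E), IsTiling G 𝒯' ∧ Satisfies G Δ 𝒯' ∧ TRigid G 𝒯' ∧ TLocIso G 𝒯 𝒯' := by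
  have hne := hsat.tilesNonempty
  obtain ⟨T, hT⟩ := h.nonempty
  obtain ⟨ρ, k, hk, hseq⟩ := exists_stabilizing_sequence hΔ h hsat hlip hsym hT
  choose hρG hρT hρs j hj hcert using hseq
  have hneρ : ∀ n, TilesNonempty (smap (ρ n) 𝒯) := fun n => hne.smap _
  set 𝒯' : Set (Set E) := ⋃ n, bt (smap (ρ n) 𝒯) T (k n)
  have hbt : ∀ n, bt 𝒯' T (k n) = bt (smap (ρ n) 𝒯) T (k n) :=
    bt_iUnion_bt hneρ hρT hk hρs
  have hne' : TilesNonempty 𝒯' := by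
    intro U hU
    obtain ⟨n, hn⟩ := mem_iUnion.1 hU
    exact hneρ n U (bt_subset (hρT n) hn)
  have hT' : T ∈ 𝒯' := mem_iUnion.2 ⟨0, mem_bt_self (hneρ 0) (hρT 0) _⟩
  have hdist : ∀ U ∈ 𝒯', ∃ i, U ∈ bt 𝒯' T i := by
    intro U hU
    obtain ⟨n, hn⟩ := mem_iUnion.1 hU
    exact ⟨k n, by rwa [hbt]⟩
  have hcopy : ∀ n i r U, U ∈ bt 𝒯' T i → i + r ≤ k n → tmap (ρ n)⁻¹ U ∈ 𝒯 ∧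
      smap (ρ n)⁻¹ (bt 𝒯' U r) = bt 𝒯 (tmap (ρ n)⁻¹ U) r := by
    intro n i r U hU hir
    have hUρ : U ∈ smap (ρ n) 𝒯 := by
      refine bt_subset (hρT n) (n := k n) ?_
      rw [← hbt]
      exact bt_mono hne' hT' (by omega) hU
    refine ⟨tmap_inv_mem hUρ, ?_⟩
    rw [bt_congr hne' (hneρ n) hT' (hρT n) (hbt n) hU hir, ← bt_smap, smap_inv_smap]
  have hloc : ∀ U ∈ 𝒯', ∀ r, ∃ ρ ∈ G, tmap ρ U ∈ 𝒯 ∧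
      smap ρ (bt 𝒯' U r) = bt 𝒯 (tmap ρ U) r := by
    intro U hU r
    obtain ⟨i, hi⟩ := hdist U hU
    exact ⟨(ρ (i + r))⁻¹, inv_mem (hρG _), hcopy _ i r U hi (hk.id_le _)⟩
  refine ⟨𝒯', h.of_locally_copied hcomp hne ⟨T, hT'⟩ hloc, ?_, ?_, ?_, ?_⟩
  · intro U hU
    obtain ⟨π, hπ, hπU, hπs⟩ := hloc U hU Δ.p
    obtain ⟨i, hi⟩ := hsat _ hπU
    exact ⟨i, PIso.trans ⟨π, hπ, hπs, rfl⟩ hi⟩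
  · intro σ hσ hσ𝒯
    by_contra hσ1
    obtain ⟨n, hn⟩ := hdist (tmap σ T) (hσ𝒯 ▸ tmap_mem_smap hT')
    obtain ⟨hmem, hs⟩ := hcopy (n + 1) 0 (j n + n) T rfl (by have := hj n; omega)
    exact not_noShortPartialSymmetry hne' hne hT' hmem (inv_mem (hρG _)) hs hσ hσ1 hσ𝒯 hn
      (hcert n)
  · intro ℰ hℰ hp hfin
    obtain ⟨m, -, hm⟩ := hlip ℰ hℰ hp hfin
    obtain ⟨hmem, hs⟩ := hcopy m 0 m T rfl (by simpa using hk.id_le m)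
    obtain ⟨σ, hσ, hσs⟩ := hm _ hmem
    refine ⟨smap (ρ m * σ) ℰ, ?_, hp.smap _, ρ m * σ, mul_mem (hρG m) hσ, rfl⟩
    rw [smap_mul]
    refine (smap_mono hσs).trans ?_
    rw [← hs, smap_smap_inv]
    exact bt_subset hT'
  · intro ℰ hℰ hp hfin
    rcases ℰ.eq_empty_or_nonempty with rfl | ⟨U, hU⟩
    · exact ⟨∅, empty_subset _, hp, 1, one_mem G, smap_one _⟩
    · obtain ⟨r, hr⟩ := hp.exists_subset_bt hne' hℰ hfin hU
      obtain ⟨π, hπ, hπU, hπs⟩ := hloc U (hℰ hU) r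
      exact ⟨smap π ℰ, (smap_mono hr).trans (hπs ▸ bt_subset hπU), hp.smap _, π, hπ, rfl⟩

end Construction

/-- **Corollary 4.2.** Let `𝒯` be a `Δ`-tiling which satisfies the local isomorphism
property. Then `𝒯` is locally isomorphic to a rigid `Δ`-tiling if and only if for every
`r ≥ 1` there exists `T ∈ 𝒯` such that no `σ ∈ G ∖ {Id}` with `𝒯σ = 𝒯` satisfies
`Tσ ∈ B_r^𝒯(T)`. -/
theorem cor_4_2 {E : Type*} [MetricSpace E] [ConnectedSpace E]
    (hcomp : ∀ (x : E) (η : ℝ), IsCompact (Metric.closedBall x η))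
    (G : Subgroup (E ≃ᵢ E)) (Δ : LocalRule E G) (hΔ : RigidRule G Δ)
    (𝒯 : Set (Set E)) (htiling : IsTiling G 𝒯) (hsat : Satisfies G Δ 𝒯)
    (hlip : TilingLIP G 𝒯) :
    (∃ 𝒯' : Set (Set E), IsTiling G 𝒯' ∧ Satisfies G Δ 𝒯' ∧ TRigid G 𝒯' ∧ TLocIso G 𝒯 𝒯') ↔
      ∀ r : ℕ, 1 ≤ r → ∃ T ∈ 𝒯,
        ∀ σ ∈ G, σ ≠ 1 → smap σ 𝒯 = 𝒯 → tmap σ T ∉ bt 𝒯 T r := by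
  constructor
  · rintro ⟨𝒯', h', hsat', hrigid, hloc⟩ r -
    have hne := hsat.tilesNonempty
    have hne' := hsat'.tilesNonempty
    by_contra! hcon
    obtain ⟨T, hT⟩ := h'.nonempty
    obtain ⟨σ, hσ, hσ1, hσ𝒯, -⟩ := exists_symmetry_of_partial hΔ h' hsat' hT (r := r) (by
      intro j
      obtain ⟨ρ, hρ, hρT, hρs⟩ :=
        hloc.exists_smap_bt_eq htiling h' hne hne' hT (j + r)
      obtain ⟨τ, hτ, hτ1, hτ𝒯, hτT⟩ := hcon _ hρT
      have key := not_noShortPartialSymmetry (ρ := ρ⁻¹) (j := j) hne hne' hρT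
        (by rwa [tmap_inv_tmap]) (inv_mem hρ)
        (by rw [← hρs, smap_inv_smap, tmap_inv_tmap]) hτ hτ1 hτ𝒯 hτT
      rwa [tmap_inv_tmap] at key)
    exact hσ1 (hrigid σ hσ hσ𝒯)
  · exact exists_rigid_locIso hcomp hΔ htiling hsat hlip

end Paper
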